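/- Let S be a nonempty compact subset of EuclideanSpace ℝ (Fin 3). Then for every q ∈ convexHull ℝ S, Metric.infDist q S ≤ √2 · max(H_b(S), R_v(S)). -/

import Mathlib

open Metric MeasureTheory

noncomputable def Hb (S : Set (EuclideanSpace ℝ (Fin 3))) : ℝ :=
  Metric.hausdorffDist (frontier S) (frontier (convexHull ℝ S))

noncomputable def Rv (S : Set (EuclideanSpace ℝ (Fin 3))) : ℝ :=
  (3 * ((volume (convexHull ℝ S)).toReal - (volume S).toReal) / (4 * Real.pi)) ^ ((1 : ℝ) / 3)

lemma aux_compact (S : Set (EuclideanSpace ℝ (Fin 3))) (hcomp : IsCompact S) :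
    IsCompact (convexHull ℝ S) := by
  have key : convexHull ℝ S = ⋃ n ∈ Set.Iio 5,
      (fun x : (Fin n → ℝ) × (Fin n → EuclideanSpace ℝ (Fin 3)) => ∑ i, x.1 i • x.2 i) ''
        (stdSimplex ℝ (Fin n) ×ˢ Set.pi Set.univ (fun _ => S)) := by
    apply Set.Subset.antisymm
    · intro x hx
      obtain ⟨ι, _, z, w, hz, hind, hw, hw1, hx⟩ := eq_pos_convex_span_of_mem_convexHull hx
      have hcard : Fintype.card ι ≤ 4 := by
        have h1 := hind.card_le_finrank_succ
        have h2 := Submodule.finrank_le (vectorSpan ℝ (Set.range z))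
        rw [finrank_euclideanSpace_fin] at h2
        omega
      let e := Fintype.equivFin ι
      simp only [Set.mem_iUnion]
      refine ⟨Fintype.card ι, Nat.lt_succ_of_le hcard, (w ∘ e.symm, z ∘ e.symm),
        ⟨⟨fun i => (hw _).le, ?_⟩, fun i _ => hz ⟨_, rfl⟩⟩, ?_⟩
      · rw [← hw1]
        exact e.symm.sum_comp w
      · rw [← hx]
        exact e.symm.sum_comp (fun i => w i • z i)
    · simp only [Set.iUnion_subset_iff]
      rintro n _ _ ⟨⟨w, z⟩, ⟨⟨hw0, hw1⟩, hz⟩, rfl⟩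
      exact (convex_convexHull ℝ S).sum_mem (fun i _ => hw0 i) hw1
        (fun i _ => subset_convexHull ℝ S (hz i trivial))
  rw [key]
  refine (Set.finite_Iio 5).isCompact_biUnion fun n _ => ?_
  refine ((isCompact_stdSimplex ℝ (Fin n)).prod (isCompact_univ_pi fun _ => hcomp)).image ?_
  fun_prop

lemma aux_vol (S : Set (EuclideanSpace ℝ (Fin 3))) (hcomp : IsCompact S)
    (hC : IsCompact (convexHull ℝ S)) (q : EuclideanSpace ℝ (Fin 3)) (t : ℝ) (ht : 0 ≤ t)
    (h1 : ball q t ⊆ convexHull ℝ S) (h2 : Disjoint (ball q t) S) : t ≤ Rv S := by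
  have hv : volume (ball q t) + volume S ≤ volume (convexHull ℝ S) := by
    rw [← measure_union h2 hcomp.measurableSet]
    exact measure_mono (Set.union_subset h1 (subset_convexHull ℝ S))
  have hv2 := ENNReal.toReal_mono hC.measure_lt_top.ne hv
  rw [ENNReal.toReal_add measure_ball_lt_top.ne hcomp.measure_lt_top.ne,
    EuclideanSpace.volume_ball_fin_three] at hv2
  have h3 : (ENNReal.ofReal t ^ 3 * ENNReal.ofReal (Real.pi * 4 / 3)).toReal
      = t ^ 3 * (Real.pi * 4 / 3) := by
    rw [ENNReal.toReal_mul, ENNReal.toReal_pow, ENNReal.toReal_ofReal ht,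
      ENNReal.toReal_ofReal (by positivity)]
  rw [h3] at hv2
  have hpi := Real.pi_pos
  have h4 : t ^ 3 ≤ 3 * ((volume (convexHull ℝ S)).toReal - (volume S).toReal) / (4 * Real.pi) := by
    rw [le_div_iff₀ (by positivity)]
    nlinarith
  unfold Rv
  calc t = (t ^ 3) ^ ((1 : ℝ) / 3) := by
        rw [← Real.rpow_natCast, ← Real.rpow_mul ht]; norm_num
    _ ≤ _ := Real.rpow_le_rpow (by positivity) h4 (by norm_num)

lemma aux_supp (C : Set (EuclideanSpace ℝ (Fin 3))) (hC : Convex ℝ C)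
    (p q s : EuclideanSpace ℝ (Fin 3)) (hb : ball q (dist q p) ⊆ C) (hp : p ∈ frontier C)
    (hs : s ∈ C) : inner ℝ (s - p) (p - q) ≤ 0 := by
  by_contra! hlt
  set a := inner ℝ (s - p) (p - q) with ha
  set e : ℝ := a / (‖s - p‖ ^ 2 + 1) with he
  have he0 : 0 < e := by positivity
  have hy : p - e • (s - p) ∈ interior C := by
    apply interior_maximal hb isOpen_ball
    rw [mem_ball, dist_comm q p, dist_eq_norm, dist_eq_norm]
    have h1 : p - e • (s - p) - q = (p - q) - e • (s - p) := by abel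
    rw [h1]
    apply lt_of_pow_lt_pow_left₀ 2 (norm_nonneg _)
    rw [norm_sub_sq_real, inner_smul_right, real_inner_comm, ← ha, norm_smul, Real.norm_eq_abs,
      mul_pow, sq_abs]
    have : e * (‖s - p‖ ^ 2 + 1) = a := by rw [he]; field_simp
    nlinarith [mul_pos he0 he0, mul_pos he0 hlt]
  have : p ∈ openSegment ℝ (p - e • (s - p)) s := by
    refine ⟨1 / (1 + e), e / (1 + e), by positivity, by positivity, by field_simp, ?_⟩
    ext i
    simp
    field_simp
    ring
  exact hp.2 (hC.openSegment_interior_self_subset_interior hy hs this)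

theorem infDist_le_sqrt_two_mul_max (S : Set (EuclideanSpace ℝ (Fin 3)))
    (hne : S.Nonempty) (hcomp : IsCompact S) :
    ∀ q ∈ convexHull ℝ S, Metric.infDist q S ≤ Real.sqrt 2 * max (Hb S) (Rv S) := by
  intro q hq
  have hC : IsCompact (convexHull ℝ S) := aux_compact S hcomp
  have hfr : ∀ A : Set (EuclideanSpace ℝ (Fin 3)), A.Nonempty → IsCompact A →
      (frontier A).Nonempty := fun A h1 h2 => nonempty_frontier_iff.2 ⟨h1, h2.ne_univ⟩
  have hfS := hfr S hne hcomp
  have hfC := hfr _ (hne.convexHull) hC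
  have hkS : IsCompact (frontier S) := hcomp.of_isClosed_subset isClosed_frontier
    hcomp.isClosed.frontier_subset
  have hkC : IsCompact (frontier (convexHull ℝ S)) := hC.of_isClosed_subset isClosed_frontier
    hC.isClosed.frontier_subset
  obtain ⟨p, hp, hpd⟩ := hkC.exists_infDist_eq_dist hfC q
  obtain ⟨s, hs, hsd⟩ := hkS.exists_infDist_eq_dist hfS p
  have hsS : s ∈ S := hcomp.isClosed.frontier_subset hs
  have hps : dist p s ≤ Hb S := by
    rw [← hsd]
    unfold Hb
    rw [hausdorffDist_comm]
    exact infDist_le_hausdorffDist_of_mem hp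
      (hausdorffEDist_ne_top_of_nonempty_of_bounded hfC hfS hkC.isBounded hkS.isBounded)
  have hball : ball q (dist q p) ⊆ convexHull ℝ S := by
    intro x hx
    by_contra hxC
    have hpre : IsPreconnected (ball q (dist q p)) := (convex_ball q _).isPreconnected
    have hq0 : q ∈ ball q (dist q p) := mem_ball_self (dist_nonneg.trans_lt hx)
    have hnf : ∀ y ∈ ball q (dist q p), y ∈ convexHull ℝ S → y ∈ interior (convexHull ℝ S) := by
      intro y hy hyC
      by_contra hyi
      have := infDist_le_dist_of_mem (x := q) (s := frontier (convexHull ℝ S))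
        ⟨subset_closure hyC, hyi⟩
      rw [hpd] at this
      rw [mem_ball, dist_comm] at hy
      linarith
    obtain ⟨y, -, hy1, hy2⟩ := hpre (interior (convexHull ℝ S)) (convexHull ℝ S)ᶜ isOpen_interior
      hC.isClosed.isOpen_compl
      (fun y hy => (em (y ∈ convexHull ℝ S)).imp (hnf y hy) id) ⟨q, hq0, hnf q hq0 hq⟩ ⟨x, hx, hxC⟩
    exact hy2 (interior_subset hy1)
  have hdis : Disjoint (ball q (infDist q S)) S := disjoint_ball_infDist
  have hm := aux_vol S hcomp hC q (min (infDist q S) (dist q p)) (le_min infDist_nonneg dist_nonneg)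
    ((ball_subset_ball (min_le_right _ _)).trans hball)
    (hdis.mono_left (ball_subset_ball (min_le_left _ _)))
  have hR := le_max_right (Hb S) (Rv S)
  have hH := le_max_left (Hb S) (Rv S)
  set m := max (Hb S) (Rv S)
  have hm0 : 0 ≤ m := (dist_nonneg.trans hps).trans hH
  rcases le_total (infDist q S) (dist q p) with h | h
  · rw [min_eq_left h] at hm
    have : 1 ≤ Real.sqrt 2 := Real.one_le_sqrt.2 (by norm_num)
    nlinarith
  · rw [min_eq_right h] at hm
    have hsup := aux_supp _ (convex_convexHull ℝ S) p q s hball hp (subset_convexHull ℝ S hsS)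
    refine (infDist_le_dist_of_mem hsS).trans ?_
    refine (pow_le_pow_iff_left₀ dist_nonneg (by positivity) two_ne_zero).1 ?_
    rw [mul_pow, Real.sq_sqrt (by norm_num)]
    have h1 : dist q s ^ 2 = dist p s ^ 2 + 2 * inner ℝ (s - p) (p - q) + dist q p ^ 2 := by
      rw [dist_comm q s, dist_comm p s, dist_comm q p, dist_eq_norm, dist_eq_norm, dist_eq_norm,
        ← norm_add_sq_real, sub_add_sub_cancel]
    have h2 : dist p s ^ 2 ≤ m ^ 2 := pow_le_pow_left₀ dist_nonneg (hps.trans hH) 2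
    have h3 : dist q p ^ 2 ≤ m ^ 2 := pow_le_pow_left₀ dist_nonneg (hm.trans hR) 2
    linarith
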